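/- Let w₁,…,w_n ∈ Σ* and define g : ℕⁿ → Σ* by g(m) = w₁^{m₁} ⋯ w_n^{m_n}. Then the relation {(m, n̄) ∈ ℕⁿ × ℕⁿ : g(m) ⊑ g(n̄)} is semilinear (as a subset of ℕ^{2n}). -/

import Mathlib

/-- `wpow w n` is the word `w` concatenated `n` times (the `n`-th power of `w`). -/
def wpow {α : Type*} (w : List α) (n : ℕ) : List α :=
  (List.replicate n w).flatten

/-- A linear subset of a commutative monoid: `{b + λ₁p₁ + ⋯ + λ_k p_k : λ_i ∈ ℕ}`. -/
def IsLinear {M : Type*} [AddCommMonoid M] (S : Set M) : Prop :=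
  ∃ (b : M) (k : ℕ) (p : Fin k → M),
    S = {x | ∃ c : Fin k → ℕ, x = b + ∑ i, c i • p i}

/-- A semilinear set is a finite union of linear sets. -/
def IsSemilinear {M : Type*} [AddCommMonoid M] (S : Set M) : Prop :=
  ∃ (m : ℕ) (T : Fin m → Set M), (∀ i, IsLinear (T i)) ∧ S = ⋃ i, T i

/-! ### Kleene-type argument: labels of walks in a finite graph form a semilinear set -/

/-- `Walk E S p x r`: a nonempty `E`-walk from `p` to `r` of total label `x`, all of whose
intermediate vertices lie in `S`. -/
inductive Walk {Q M : Type*} [AddCommMonoid M] (E : Q → M → Q → Prop) (S : Set Q) :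
    Q → M → Q → Prop
  | one {p x r} : E p x r → Walk E S p x r
  | cons {p x q y r} : E p x q → q ∈ S → Walk E S q y r → Walk E S p (x + y) r

theorem Walk.mono {Q M : Type*} [AddCommMonoid M] {E : Q → M → Q → Prop} {S T : Set Q}
    (h : S ⊆ T) {p x r} (hw : Walk E S p x r) : Walk E T p x r := by
  induction hw with
  | one h1 => exact .one h1
  | cons h1 h2 _ ih => exact .cons h1 (h h2) ih

theorem Walk.trans {Q M : Type*} [AddCommMonoid M] {E : Q → M → Q → Prop} {S : Set Q}
    {p x k y r} (hw : Walk E S p x k) (hk : k ∈ S) (hy : Walk E S k y r) :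
    Walk E S p (x + y) r := by
  induction hw with
  | one h1 => exact .cons h1 hk hy
  | cons h1 h2 _ ih => rw [add_assoc]; exact .cons h1 h2 (ih hk hy)

open Pointwise in
theorem walk_insert {Q M : Type*} [AddCommMonoid M] (E : Q → M → Q → Prop) (S : Set Q)
    (k p r : Q) :
    {x | Walk E (insert k S) p x r} = {x | Walk E S p x r} ∪
      ({x | Walk E S p x k} + (AddSubmonoid.closure {x | Walk E S k x k} : Set M)
        + {x | Walk E S k x r}) := by
  ext x
  constructor
  · intro h
    change Walk E (insert k S) p x r at h
    induction h with
    | one h1 => exact Or.inl (.one h1)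
    | @cons p x q y r h1 h2 _ ih =>
      rcases h2 with rfl | h2
      · right
        rcases ih with ih | ⟨_, ⟨a, ha, b, hb, rfl⟩, c, hc, rfl⟩
        · exact ⟨x + 0, ⟨x, .one h1, 0, zero_mem _, rfl⟩, y, ih, by simp⟩
        · refine ⟨x + (a + b), ⟨x, .one h1, a + b, ?_, rfl⟩, c, hc, by simp [add_assoc]⟩
          exact add_mem (AddSubmonoid.subset_closure ha) hb
      · rcases ih with ih | ⟨_, ⟨a, ha, b, hb, rfl⟩, c, hc, rfl⟩
        · exact Or.inl (.cons h1 h2 ih)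
        · exact Or.inr ⟨x + a + b, ⟨x + a, .cons h1 h2 ha, b, hb, rfl⟩, c, hc,
            by simp [add_assoc]⟩
  · have hsub : S ⊆ insert k S := Set.subset_insert k S
    have hk : k ∈ insert k S := Set.mem_insert k S
    rintro (h | ⟨_, ⟨a, ha, b, hb, rfl⟩, c, hc, rfl⟩)
    · exact Walk.mono hsub h
    · have key : ∀ c, Walk E (insert k S) k c r → Walk E (insert k S) k (b + c) r := by
        refine AddSubmonoid.closure_induction
          (motive := fun b _ => ∀ c, Walk E (insert k S) k c r →
            Walk E (insert k S) k (b + c) r) ?_ ?_ ?_ hb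
        · intro z hz c hc
          exact (Walk.mono hsub hz).trans hk hc
        · intro c hc; simpa using hc
        · intro y z _ _ hy hz c hc
          rw [add_assoc]; exact hy _ (hz _ hc)
      change Walk E (insert k S) p (a + b + c) r
      rw [add_assoc]
      exact (Walk.mono hsub ha).trans hk (key c (Walk.mono hsub hc))

theorem walk_semilinear {Q M : Type*} [AddCommMonoid M] (E : Q → M → Q → Prop)
    (hE : ∀ p r, {x | E p x r}.Finite) (S : Set Q) (hS : S.Finite) :
    ∀ p r, IsSemilinearSet {x | Walk E S p x r} := by
  induction S, hS using Set.Finite.induction_on with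
  | empty =>
    intro p r
    refine IsSemilinearSet.of_finite ((hE p r).subset ?_)
    intro x hx
    cases hx with
    | one h => exact h
    | cons _ h _ => exact h.elim
  | @insert k S _ _ ih =>
    intro p r
    rw [walk_insert]
    exact (ih p r).union (((ih p k).add (ih k k).closure).add (ih k r))

/-! ### The automaton generating the words `w₀^{m₀} ⋯ w_{n-1}^{m_{n-1}}` -/

/-- From position `k` with pending suffix `s`, the word `u` is generated with exponents `m`. -/
inductive Gen {A : Type} (n : ℕ) (w : ℕ → List A) : ℕ × List A → List A → (ℕ → ℕ) → Prop
  | nil : Gen n w (n, []) [] 0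
  | emit {k s u m} (a : A) : Gen n w (k, s) u m → Gen n w (k, a :: s) (a :: u) m
  | next {k u m} : k < n → Gen n w (k + 1, []) u m → Gen n w (k, []) u m
  | pump {k u m} : k < n → Gen n w (k, w k) u m → Gen n w (k, []) u (Pi.single k 1 + m)

/-- The explicit word. -/
def gval {A : Type} (n : ℕ) (w : ℕ → List A) (k : ℕ) (m : ℕ → ℕ) : List A :=
  (List.range' k (n - k)).flatMap fun i => wpow (w i) (m i)

theorem wpow_succ {A : Type} (w : List A) (c : ℕ) : wpow w (c + 1) = w ++ wpow w c := by
  simp [wpow, List.replicate_succ]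

theorem gval_lt {A : Type} {n : ℕ} (w : ℕ → List A) {k : ℕ} (h : k < n) (m : ℕ → ℕ) :
    gval n w k m = wpow (w k) (m k) ++ gval n w (k + 1) m := by
  obtain ⟨d, hd⟩ : ∃ d, n - k = d + 1 := ⟨n - k - 1, by omega⟩
  have hd' : n - (k + 1) = d := by omega
  simp [gval, hd, hd', List.range'_succ]

theorem gval_congr {A : Type} {n : ℕ} (w : ℕ → List A) {k : ℕ} {m m' : ℕ → ℕ}
    (h : ∀ i, k ≤ i → i < n → m i = m' i) : gval n w k m = gval n w k m' := by
  unfold gval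
  refine List.flatMap_congr fun i hi => ?_
  rw [List.mem_range'_1] at hi
  rw [h i hi.1 (by omega)]

theorem Gen.sound {A : Type} {n : ℕ} {w : ℕ → List A} {p u m} (h : Gen n w p u m) :
    u = p.2 ++ gval n w p.1 m ∧ ∀ i < p.1, m i = 0 := by
  induction h with
  | nil => simp [gval]
  | emit a _ ih => exact ⟨by simp [ih.1], ih.2⟩
  | @next k u m hk _ ih =>
    refine ⟨?_, fun i hi => ih.2 i (by simp at hi ⊢; omega)⟩
    rw [gval_lt w hk, ih.2 k (by simp)]
    simpa [wpow] using ih.1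
  | @pump k u m hk _ ih =>
    refine ⟨?_, fun i hi => ?_⟩
    · have h2 : gval n w (k + 1) (Pi.single k 1 + m) = gval n w (k + 1) m := by
        refine gval_congr w fun i hi _ => ?_
        have : i ≠ k := by omega
        simp [this]
      rw [gval_lt w hk, h2]
      have h3 : (Pi.single k 1 + m : ℕ → ℕ) k = m k + 1 := by simp [add_comm]
      rw [h3, wpow_succ, ih.1]
      simp [gval_lt w hk]
    · have : i ≠ k := by simp at hi; omega
      simpa [this] using ih.2 i hi

theorem Gen.append {A : Type} {n : ℕ} {w : ℕ → List A} {k u m} (h : Gen n w (k, []) u m)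
    (s : List A) : Gen n w (k, s) (s ++ u) m := by
  induction s with
  | nil => exact h
  | cons a s ih => exact .emit a ih

theorem Gen.iter {A : Type} {n : ℕ} {w : ℕ → List A} {k u m} (hk : k < n)
    (h : Gen n w (k + 1, []) u m) (c : ℕ) :
    Gen n w (k, []) (wpow (w k) c ++ u) (Pi.single k c + m) := by
  induction c with
  | zero => simpa [wpow] using Gen.next hk h
  | succ c ih =>
    have h1 := Gen.pump hk (ih.append (w k))
    rw [wpow_succ, List.append_assoc]
    convert h1 using 1
    rw [← add_assoc, ← Pi.single_add, add_comm 1 c]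

theorem Gen.complete {A : Type} {n : ℕ} (w : ℕ → List A) (m : ℕ → ℕ) :
    ∀ d k, k + d = n → Gen n w (k, []) (gval n w k m) (fun i => if k ≤ i ∧ i < n then m i else 0) := by
  intro d
  induction d with
  | zero =>
    rintro k rfl
    have : (fun i => if k ≤ i ∧ i < k + 0 then m i else 0) = (0 : ℕ → ℕ) := by
      funext i; simp
    rw [this]
    simpa [gval] using (Gen.nil : Gen k w _ _ _)
  | succ d ih =>
    intro k hk
    have h := (ih (k + 1) (by omega)).iter (by omega) (m k)
    rw [gval_lt w (by omega)]
    convert h using 1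
    funext i
    by_cases hi : i = k
    · subst hi; simp; omega
    · have : (k ≤ i ∧ i < n) ↔ (k + 1 ≤ i ∧ i < n) := by omega
      simp [hi, this]

/-! ### The product automaton -/

/-- Edges of the product automaton recognising the subword relation. -/
inductive Edge {A : Type} (n : ℕ) (w : ℕ → List A) :
    (ℕ × List A) × (ℕ × List A) → (ℕ → ℕ) × (ℕ → ℕ) → (ℕ × List A) × (ℕ × List A) → Prop
  | stay {p} : Edge n w p 0 p
  | keep {k s l t} (a : A) : Edge n w ((k, a :: s), (l, a :: t)) 0 ((k, s), (l, t))
  | drop {p l t} (a : A) : Edge n w (p, (l, a :: t)) 0 (p, (l, t))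
  | nextL {k q} : k < n → Edge n w ((k, []), q) 0 ((k + 1, []), q)
  | nextR {p k} : k < n → Edge n w (p, (k, [])) 0 (p, (k + 1, []))
  | pumpL {k q} : k < n → Edge n w ((k, []), q) (Pi.single k 1, 0) ((k, w k), q)
  | pumpR {p k} : k < n → Edge n w (p, (k, [])) (0, Pi.single k 1) (p, (k, w k))

theorem edge_finite {A : Type} (n : ℕ) (w : ℕ → List A) (p r) : {x | Edge n w p x r}.Finite := by
  refine Set.Finite.subset (s := {0, (Pi.single p.1.1 1, 0), (0, Pi.single p.2.1 1)})
    (by simp) ?_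
  intro x hx
  cases hx <;> simp

/-- The finite set of states of the generating automaton. -/
def States {A : Type} (n : ℕ) (w : ℕ → List A) : Set (ℕ × List A) :=
  {p | p.1 ≤ n ∧ (p.2 = [] ∨ ∃ i < n, p.2 <:+ w i)}

theorem states_finite {A : Type} (n : ℕ) (w : ℕ → List A) : (States n w).Finite := by
  have h : ({s | s = [] ∨ ∃ i < n, s <:+ w i} : Set (List A)).Finite := by
    have : {s | ∃ i < n, s <:+ w i} = ⋃ i ∈ Set.Iio n, {s | s ∈ (w i).tails} := by
      ext s; simp
    rw [Set.setOf_or, this]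
    refine Set.Finite.union (Set.finite_singleton ([] : List A)) ?_
    exact (Set.finite_Iio n).biUnion fun i _ => List.finite_toSet _
  exact ((Set.finite_Iic n).prod h).subset fun p hp => ⟨hp.1, hp.2⟩

theorem states_tail {A : Type} {n : ℕ} {w : ℕ → List A} {k a s}
    (h : (k, a :: s) ∈ States n w) : (k, s) ∈ States n w := by
  obtain ⟨h1, h2 | ⟨i, hi, h2⟩⟩ := h
  · simp at h2
  · exact ⟨h1, Or.inr ⟨i, hi, (List.suffix_cons a s).trans h2⟩⟩

theorem states_next {A : Type} {n : ℕ} {w : ℕ → List A} {k}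
    (h : k < n) : (k + 1, []) ∈ States n w := ⟨h, Or.inl rfl⟩

theorem states_pump {A : Type} {n : ℕ} {w : ℕ → List A} {k}
    (h : k < n) : (k, w k) ∈ States n w := ⟨h.le, Or.inr ⟨k, h, List.suffix_rfl⟩⟩

theorem walk_sound {A : Type} {n : ℕ} {w : ℕ → List A} {S p x r} (h : Walk (Edge n w) S p x r)
    (hr : ∃ u v, Gen n w r.1 u 0 ∧ Gen n w r.2 v 0 ∧ u.Sublist v) :
    ∃ u v, Gen n w p.1 u x.1 ∧ Gen n w p.2 v x.2 ∧ u.Sublist v := by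
  have step : ∀ {p x q y}, Edge n w p x q →
      (∃ u v, Gen n w q.1 u y.1 ∧ Gen n w q.2 v y.2 ∧ u.Sublist v) →
      ∃ u v, Gen n w p.1 u (x + y).1 ∧ Gen n w p.2 v (x + y).2 ∧ u.Sublist v := by
    rintro p x q y hE ⟨u, v, hu, hv, huv⟩
    cases hE with
    | stay => exact ⟨u, v, by simpa using hu, by simpa using hv, huv⟩
    | keep a =>
      exact ⟨a :: u, a :: v, by simpa using hu.emit a, by simpa using hv.emit a, huv.cons_cons a⟩
    | drop a => exact ⟨u, a :: v, by simpa using hu, by simpa using hv.emit a, huv.cons a⟩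
    | nextL hk => exact ⟨u, v, by simpa using hu.next hk, by simpa using hv, huv⟩
    | nextR hk => exact ⟨u, v, by simpa using hu, by simpa using hv.next hk, huv⟩
    | pumpL hk => exact ⟨u, v, by simpa using hu.pump hk, by simpa using hv, huv⟩
    | pumpR hk => exact ⟨u, v, by simpa using hu, by simpa using hv.pump hk, huv⟩
  induction h with
  | one h1 => simpa using step (y := 0) h1 hr
  | cons h1 _ _ ih => exact step h1 (ih hr)

theorem walk_complete {A : Type} {n : ℕ} {w : ℕ → List A} {q v m'} (hq : Gen n w q v m') :
    q ∈ States n w → ∀ {p u m}, Gen n w p u m → p ∈ States n w → u.Sublist v →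
      Walk (Edge n w) (States n w ×ˢ States n w) (p, q) (m, m') ((n, []), (n, [])) := by
  induction hq with
  | nil =>
    intro hqS p u m hp
    induction hp with
    | nil => intro _ _; exact .one .stay
    | emit a _ _ => intro _ h; simp at h
    | next hk _ ih =>
      intro _ h
      simpa using Walk.cons (.nextL hk) (Set.mk_mem_prod (states_next hk) (hqS)) (ih (states_next hk) h)
    | pump hk _ ih =>
      intro _ h
      simpa using Walk.cons (.pumpL hk) (Set.mk_mem_prod (states_pump hk) (hqS)) (ih (states_pump hk) h)
  | @emit l t v m' a hv ihq =>
    intro hqS p u m hp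
    have hqS' := states_tail hqS
    have dropcase : ∀ {p u m}, Gen n w p u m → p ∈ States n w → u.Sublist v →
        Walk (Edge n w) (States n w ×ˢ States n w) (p, (l, a :: t)) (m, m')
          ((n, []), (n, [])) := fun hp hpS h => by
      simpa using Walk.cons (.drop a) (Set.mk_mem_prod (hpS) (hqS')) (ihq hqS' hp hpS h)
    induction hp with
    | nil => intro hpS _; exact dropcase .nil hpS (List.nil_sublist _)
    | emit b hu _ =>
      intro hpS h
      cases h with
      | cons _ h => exact dropcase (.emit b hu) hpS h
      | cons_cons _ h =>
        have hpS' := states_tail hpS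
        simpa using Walk.cons (.keep a) (Set.mk_mem_prod (hpS') (hqS')) (ihq hqS' hu hpS' h)
    | next hk _ ih =>
      intro _ h
      simpa using Walk.cons (.nextL hk) (Set.mk_mem_prod (states_next hk) (hqS)) (ih (states_next hk) h)
    | pump hk _ ih =>
      intro _ h
      simpa using Walk.cons (.pumpL hk) (Set.mk_mem_prod (states_pump hk) (hqS)) (ih (states_pump hk) h)
  | next hk _ ih =>
    intro _ p u m hp hpS h
    simpa using Walk.cons (.nextR hk) (Set.mk_mem_prod (hpS) (states_next hk)) (ih (states_next hk) hp hpS h)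
  | pump hk _ ih =>
    intro _ p u m hp hpS h
    simpa using Walk.cons (.pumpR hk) (Set.mk_mem_prod (hpS) (states_pump hk)) (ih (states_pump hk) hp hpS h)

/-! ### Conclusion -/

theorem IsLinearSet.toIsLinear {M : Type*} [AddCommMonoid M] {S : Set M} (h : IsLinearSet S) :
    IsLinear S := by
  obtain ⟨a, k, f, rfl⟩ := isLinearSet_iff_exists_fin_addMonoidHom.1 h
  refine ⟨a, k, fun i => f (Pi.single i 1), ?_⟩
  have key : ∀ c : Fin k → ℕ, f c = ∑ i, c i • f (Pi.single i 1) := by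
    intro c
    conv_lhs => rw [← Finset.univ_sum_single c]
    rw [map_sum]
    refine Finset.sum_congr rfl fun i _ => ?_
    rw [← map_nsmul, ← Pi.single_smul]
    simp
  ext x
  simp only [Set.mem_vadd_set, Set.mem_range, vadd_eq_add, Set.mem_setOf_eq]
  constructor
  · rintro ⟨_, ⟨c, rfl⟩, rfl⟩
    exact ⟨c, by rw [key]⟩
  · rintro ⟨c, rfl⟩
    exact ⟨_, ⟨c, rfl⟩, by rw [key]⟩

theorem IsSemilinearSet.toIsSemilinear {M : Type*} [AddCommMonoid M] {S : Set M}
    (h : IsSemilinearSet S) : IsSemilinear S := by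
  obtain ⟨F, hF, hlin, rfl⟩ := h
  obtain ⟨m, T, _, rfl⟩ := hF.fin_param
  exact ⟨m, T, fun i => (hlin _ ⟨i, rfl⟩).toIsLinear, by rw [Set.sUnion_range]⟩

theorem gval_ofFn {A : Type} (n : ℕ) (w : ℕ → List A) (m : ℕ → ℕ) :
    gval n w 0 m = (List.ofFn fun i : Fin n => wpow (w i) (m i)).flatten := by
  rw [gval, List.flatMap_def]
  congr 1
  apply List.ext_getElem <;> simp

theorem gval_ofFn' {A : Type} (n : ℕ) (w : Fin n → List A) (w' : ℕ → List A)
    (hw : ∀ i : Fin n, w' i = w i) (m : ℕ → ℕ) (m' : Fin n → ℕ) (hm : ∀ i : Fin n, m i = m' i) :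
    gval n w' 0 m = (List.ofFn fun i : Fin n => wpow (w i) (m' i)).flatten := by
  simp [gval_ofFn, hw, hm]

/-- The relation `{(m, n̄) : w₁^{m₁}⋯w_n^{m_n} ⊑ w₁^{n̄₁}⋯w_n^{n̄_n}}` is semilinear. -/
theorem subword_relation_semilinear {A : Type} [Fintype A] (n : ℕ) (w : Fin n → List A) :
    IsSemilinear {mn : (Fin n → ℕ) × (Fin n → ℕ) |
      (List.ofFn fun i => wpow (w i) (mn.1 i)).flatten.Sublist
        (List.ofFn fun i => wpow (w i) (mn.2 i)).flatten} := by
  classical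
  apply IsSemilinearSet.toIsSemilinear
  let w' : ℕ → List A := fun k => if h : k < n then w ⟨k, h⟩ else []
  have hw' : ∀ i : Fin n, w' i = w i := fun i => by simp [w']
  let res : (ℕ → ℕ) →+ (Fin n → ℕ) :=
    { toFun := fun m i => m i
      map_zero' := rfl
      map_add' := fun _ _ => rfl }
  have hsl := (walk_semilinear (Edge n w') (edge_finite n w') _
    ((states_finite n w').prod (states_finite n w')) ((0, []), (0, [])) ((n, []), (n, []))).image
    (res.prodMap res)
  convert hsl using 1
  ext ⟨m, m'⟩
  constructor
  · intro h
    let ext : (Fin n → ℕ) → ℕ → ℕ := fun m k => if h : k < n then m ⟨k, h⟩ else 0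
    have hext : ∀ m (i : Fin n), ext m i = m i := fun m i => by simp [ext]
    have h0 : ((0, []) : ℕ × List A) ∈ States n w' := ⟨Nat.zero_le _, Or.inl rfl⟩
    refine ⟨_, walk_complete (Gen.complete w' (ext m') n 0 (by simp)) h0
      (Gen.complete w' (ext m) n 0 (by simp)) h0 ?_, ?_⟩
    · rw [gval_ofFn' n w w' hw' _ _ (hext m), gval_ofFn' n w w' hw' _ _ (hext m')]
      exact h
    · refine Prod.ext ?_ ?_ <;> funext i <;> simp [res, ext]
  · rintro ⟨⟨x, y⟩, h, hxy⟩
    obtain ⟨u, v, hu, hv, huv⟩ := walk_sound h ⟨[], [], .nil, .nil, List.Sublist.refl _⟩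
    have h1 := hu.sound.1
    have h2 := hv.sound.1
    simp only [List.nil_append] at h1 h2
    have hm : res x = m := congrArg Prod.fst hxy
    have hm' : res y = m' := congrArg Prod.snd hxy
    rw [h1, h2, gval_ofFn' n w w' hw' x m fun i => congrFun hm i,
      gval_ofFn' n w w' hw' y m' fun i => congrFun hm' i] at huv
    exact huv
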